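/- Let J be a 4×4 complex positive semidefinite matrix with trace 1, regarded as a bipartite state on ℂ² ⊗ ℂ², whose two partial traces (over each tensor factor) both equal (1/2)I₂. Then there exist 2×2 unitaries U₁, U₂ and a probability vector λ : {0,1}² → ℝ such that (U₁ ⊗ U₂) J (U₁ ⊗ U₂)† = Σ_{n,m} λ_{nm} |Φ_nm⟩⟨Φ_nm|; that is, the Choi state of every qubit unital channel can be diagonalised in the Bell basis by local unitaries. -/

import Mathlib

open Matrix Kronecker
open scoped ComplexOrder

noncomputable section

/-- A probability vector: nonnegative entries summing to 1. -/
def IsProbVec {ι : Type*} [Fintype ι] (p : ι → ℝ) : Prop :=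
  (∀ i, 0 ≤ p i) ∧ ∑ i, p i = 1

/-- The qubit discrete Weyl operators `W_nm = Σ_c (−1)^{mc} |n+c⟩⟨c|`. -/
def Wq (n m : ZMod 2) : Matrix (ZMod 2) (ZMod 2) ℂ :=
  Matrix.of fun r c => if r = n + c then (-1 : ℂ) ^ (m.val * c.val) else 0

/-- The qubit Bell basis vector `|Φ_nm⟩ = (I ⊗ W_nm)|Φ_00⟩`. -/
def bell (n m : ZMod 2) : ZMod 2 × ZMod 2 → ℂ :=
  fun p => ((Real.sqrt 2 : ℝ) : ℂ)⁻¹ * Wq n m p.2 p.1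

/-- The Bell projector `|Φ_nm⟩⟨Φ_nm|`. -/
def bellProj (n m : ZMod 2) : Matrix (ZMod 2 × ZMod 2) (ZMod 2 × ZMod 2) ℂ :=
  Matrix.of fun p q => bell n m p * (starRingEnd ℂ) (bell n m q)

/-- Partial trace over the first tensor factor. -/
def ptrFst (J : Matrix (ZMod 2 × ZMod 2) (ZMod 2 × ZMod 2) ℂ) :
    Matrix (ZMod 2) (ZMod 2) ℂ :=
  Matrix.of fun i j => ∑ k : ZMod 2, J (k, i) (k, j)

/-- Partial trace over the second tensor factor. -/
def ptrSnd (J : Matrix (ZMod 2 × ZMod 2) (ZMod 2 × ZMod 2) ℂ) :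
    Matrix (ZMod 2) (ZMod 2) ℂ :=
  Matrix.of fun i j => ∑ k : ZMod 2, J (i, k) (j, k)


open Quaternion

/-- Quaternions as 2x2 matrices. -/
def qm (a : ℍ[ℝ]) : Matrix (ZMod 2) (ZMod 2) ℂ :=
  Matrix.of fun r c =>
    if r = 0 then (if c = 0 then ⟨a.re, a.imI⟩ else ⟨a.imJ, a.imK⟩)
    else (if c = 0 then ⟨-a.imJ, a.imK⟩ else ⟨a.re, -a.imI⟩)

lemma zsum {M : Type*} [AddCommMonoid M] (f : ZMod 2 → M) : ∑ i, f i = f 0 + f 1 :=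
  Fin.sum_univ_two f

lemma zall {P : ZMod 2 → Prop} (h0 : P 0) (h1 : P 1) : ∀ i, P i := by
  intro i
  fin_cases i
  · exact h0
  · exact h1

lemma z10 : (1 : ZMod 2) ≠ 0 := by decide

lemma qm_mul (a b : ℍ[ℝ]) : qm (a * b) = qm a * qm b := by
  ext r c
  revert r c
  refine zall (zall ?_ ?_) (zall ?_ ?_) <;>
  · apply Complex.ext <;> simp [qm, Matrix.mul_apply, zsum] <;> ring

lemma qm_star (a : ℍ[ℝ]) : qm (star a) = (qm a)ᴴ := by
  ext r c
  revert r c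
  refine zall (zall ?_ ?_) (zall ?_ ?_) <;>
  · apply Complex.ext <;> simp [qm]

lemma qm_one : qm 1 = 1 := by
  ext r c
  revert r c
  refine zall (zall ?_ ?_) (zall ?_ ?_) <;>
  · apply Complex.ext <;> simp [qm]

/-- The quaternion units labelled by pairs. -/
def qe (k : ZMod 2 × ZMod 2) : ℍ[ℝ] :=
  ⟨if k = (0,0) then 1 else 0, if k = (0,1) then 1 else 0,
    if k = (1,1) then 1 else 0, if k = (1,0) then 1 else 0⟩

lemma qe_re (k) : (qe k).re = if k = (0,0) then 1 else 0 := rfl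
lemma qe_imI (k) : (qe k).imI = if k = (0,1) then 1 else 0 := rfl
lemma qe_imJ (k) : (qe k).imJ = if k = (1,1) then 1 else 0 := rfl
lemma qe_imK (k) : (qe k).imK = if k = (1,0) then 1 else 0 := rfl

/-- Real inner product of quaternions. -/
def qi (a b : ℍ[ℝ]) : ℝ := a.re * b.re + a.imI * b.imI + a.imJ * b.imJ + a.imK * b.imK

/-- Simultaneous conjugation of an anticommuting pair of imaginary units to i, j. -/
lemma exists_conj (p1 p2 : ℍ[ℝ]) (h1 : p1 * p1 = -1) (h2 : p2 * p2 = -1)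
    (h12 : p1 * p2 = - (p2 * p1)) :
    ∃ q : ℍ[ℝ], q ≠ 0 ∧ q * p1 = qe (0,1) * q ∧ q * p2 = qe (1,1) * q := by
  set i := qe (0,1) with hi
  set j := qe (1,1) with hj
  have ii : i * i = -1 := by ext <;> simp [hi, qe_re, qe_imI, qe_imJ, qe_imK]
  have jj : j * j = -1 := by ext <;> simp [hj, qe_re, qe_imI, qe_imJ, qe_imK]
  have ij : j * i = - (i * j) := by ext <;> simp [hi, hj, qe_re, qe_imI, qe_imJ, qe_imK]
  let F : ℍ[ℝ] → ℍ[ℝ] := fun x => x - i * x * p1 - j * x * p2 - (i * j) * x * (p1 * p2)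
  have F1 : ∀ x, F x * p1 = i * F x := by
    intro x
    have e1 : p2 * p1 = -(p1 * p2) := by rw [h12, neg_neg]
    have e2 : p1 * p2 * p1 = p2 := by rw [mul_assoc, e1, mul_neg, ← mul_assoc, h1]; simp
    have e3 : i * (i * j) = -j := by rw [← mul_assoc, ii]; simp
    calc F x * p1 = x * p1 - i * x * (p1 * p1) - j * x * (p2 * p1)
          - (i * j) * x * (p1 * p2 * p1) := by simp only [F]; noncomm_ring
      _ = i * x - (i * i) * x * p1 - (i * j) * x * p2 - (i * (i * j)) * x * (p1 * p2) := by
          rw [h1, e1, e2, ii, e3]; noncomm_ring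
      _ = i * F x := by simp only [F]; noncomm_ring
  have F2 : ∀ x, F x * p2 = j * F x := by
    intro x
    have e2 : p1 * p2 * p2 = -p1 := by rw [mul_assoc, h2]; simp
    have e3 : j * (i * j) = i := by rw [← mul_assoc, ij, neg_mul, mul_assoc, jj]; simp
    calc F x * p2 = x * p2 - i * x * (p1 * p2) - j * x * (p2 * p2)
          - (i * j) * x * (p1 * p2 * p2) := by simp only [F]; noncomm_ring
      _ = j * x - (j * i) * x * p1 - (j * j) * x * p2 - (j * (i * j)) * x * (p1 * p2) := by
          rw [h2, e2, ij, jj, e3]; noncomm_ring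
      _ = j * F x := by simp only [F]; noncomm_ring
  by_contra hcon
  have hz : ∀ x, F x = 0 := by
    intro x
    by_contra hx
    exact hcon ⟨F x, hx, F1 x, F2 x⟩
  have key : F 1 - i * F i - j * F j - (i * j) * F (i * j) = ((4 : ℝ) : ℍ[ℝ]) := by
    ext <;> simp [F, hi, hj, qe_re, qe_imI, qe_imJ, qe_imK] <;> ring
  simp only [hz] at key
  have := congrArg (fun z : ℍ[ℝ] => z.re) key
  norm_num at this

lemma qi_mul_left (v a b : ℍ[ℝ]) : qi (v * a) (v * b) = qi v v * qi a b := by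
  simp [qi]; ring

lemma qi_mul_right (v a b : ℍ[ℝ]) : qi (a * v) (b * v) = qi v v * qi a b := by
  simp [qi]; ring

lemma qi_self_mul (v : ℍ[ℝ]) : star v * v = (qi v v : ℝ) := by
  ext <;> simp [qi] <;> ring

lemma qi_self_mul2 (v : ℍ[ℝ]) : v * star v = (qi v v : ℝ) := by
  ext <;> simp [qi] <;> ring

lemma qi_star (v : ℍ[ℝ]) : qi (star v) (star v) = qi v v := by
  simp [qi]

lemma exists_uv (a : ZMod 2 × ZMod 2 → ℍ[ℝ])
    (ha : ∀ k l, qi (a k) (a l) = if k = l then 1 else 0) :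
    ∃ u v : ℍ[ℝ], qi u u = 1 ∧ qi v v = 1 ∧
      ∀ k, v * a k * u = qe k ∨ v * a k * u = - qe k := by
  set b : ZMod 2 × ZMod 2 → ℍ[ℝ] := fun k => star (a (0,0)) * a k with hb
  have hbi : ∀ k l, qi (b k) (b l) = if k = l then 1 else 0 := by
    intro k l
    rw [hb]; simp only
    rw [qi_mul_left, qi_star, ha, ha]; simp
  have hb0 : b (0,0) = 1 := by
    rw [hb]; simp only; rw [qi_self_mul, ha]; simp
  have hre : ∀ k, k ≠ (0,0) → (b k).re = 0 := by
    intro k hk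
    have := hbi k (0,0)
    rw [hb0, if_neg hk] at this
    simpa [qi] using this
  have hsq : ∀ k, k ≠ (0,0) → b k * b k = -1 := by
    intro k hk
    have h1 := hre k hk
    have h2 := hbi k k
    simp [qi, h1] at h2
    ext <;> simp [h1] <;> linarith
  have hanti : b (0,1) * b (1,1) = -(b (1,1) * b (0,1)) := by
    have h1 := hre (0,1) (by decide)
    have h2 := hre (1,1) (by decide)
    have h3 := hbi (0,1) (1,1)
    rw [if_neg (by decide)] at h3
    simp [qi, h1] at h3
    ext <;> simp [h1, h2] <;> linarith
  obtain ⟨q, hq0, hq1, hq2⟩ := exists_conj (b (0,1)) (b (1,1)) (hsq _ (by decide))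
    (hsq _ (by decide)) hanti
  have hpos : 0 < qi q q := by
    rcases lt_or_ge 0 (qi q q) with h | h
    · exact h
    · exfalso
      apply hq0
      simp only [qi] at h
      ext <;> simp <;> nlinarith [mul_self_nonneg q.re, mul_self_nonneg q.imI,
        mul_self_nonneg q.imJ, mul_self_nonneg q.imK]
  set t : ℝ := (Real.sqrt (qi q q))⁻¹ with ht
  have htt : t * t * qi q q = 1 := by
    rw [ht, ← mul_inv, Real.mul_self_sqrt hpos.le, inv_mul_cancel₀ hpos.ne']
  set w : ℍ[ℝ] := t • q with hw
  have hww : qi w w = 1 := by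
    rw [← htt, hw]; simp [qi]; ring
  have hw1 : w * b (0,1) = qe (0,1) * w := by
    rw [hw, smul_mul_assoc, hq1, mul_smul_comm]
  have hw2 : w * b (1,1) = qe (1,1) * w := by
    rw [hw, smul_mul_assoc, hq2, mul_smul_comm]
  have hwst : w * star w = 1 := by rw [qi_self_mul2, hww]; simp
  have c0 : w * b (0,0) * star w = qe (0,0) := by
    rw [hb0, mul_one, hwst]; ext <;> simp [qe_re, qe_imI, qe_imJ, qe_imK]
  have c1 : w * b (0,1) * star w = qe (0,1) := by rw [hw1, mul_assoc, hwst, mul_one]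
  have c2 : w * b (1,1) * star w = qe (1,1) := by rw [hw2, mul_assoc, hwst, mul_one]
  have hc : ∀ k l, qi (w * b k * star w) (w * b l * star w) = if k = l then 1 else 0 := by
    intro k l
    rw [qi_mul_right, qi_mul_left, qi_star, hww, hbi]; simp
  refine ⟨star w, w * star (a (0,0)), by rw [qi_star, hww], ?_, ?_⟩
  · rw [qi_mul_left, qi_star, hww, ha]; simp
  · have e : ∀ k, w * star (a (0,0)) * a k * star w = w * b k * star w := by
      intro k; rw [hb]; simp only [mul_assoc]
    simp only [e]
    have h0 := hc (1,0) (0,0)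
    have h1 := hc (1,0) (0,1)
    have h2 := hc (1,0) (1,1)
    have h3 := hc (1,0) (1,0)
    rw [c0, if_neg (by decide)] at h0
    rw [c1, if_neg (by decide)] at h1
    rw [c2, if_neg (by decide)] at h2
    rw [if_pos rfl] at h3
    have c3 : w * b (1,0) * star w = qe (1,0) ∨ w * b (1,0) * star w = - qe (1,0) := by
      generalize w * b (1,0) * star w = x at h0 h1 h2 h3
      simp [qi, qe_re, qe_imI, qe_imJ, qe_imK] at h0 h1 h2
      simp [qi, h0, h1, h2] at h3
      rcases mul_self_eq_one_iff.mp h3 with h | h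
      · left; ext <;> simp [qe_re, qe_imI, qe_imJ, qe_imK, h0, h1, h2, h]
      · right; ext <;> simp [qe_re, qe_imI, qe_imJ, qe_imK, h0, h1, h2, h]
    rintro ⟨n, m⟩
    revert n m
    exact zall (zall (Or.inl c0) (Or.inl c1)) (zall c3 (Or.inl c2))

/-- Vectorisation of a matrix. -/
def vc (A : Matrix (ZMod 2) (ZMod 2) ℂ) : ZMod 2 × ZMod 2 → ℂ :=
  fun p => ((Real.sqrt 2 : ℝ) : ℂ)⁻¹ * A p.2 p.1

lemma kron_vc (U V A : Matrix (ZMod 2) (ZMod 2) ℂ) :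
    (U ⊗ₖ V) *ᵥ vc A = vc (V * A * Uᵀ) := by
  ext ⟨r, s⟩
  simp [vc, Matrix.mulVec, dotProduct, Matrix.mul_apply, Fintype.sum_prod_type, zsum]
  ring

/-- The magic basis. -/
def magic : Matrix (ZMod 2 × ZMod 2) (ZMod 2 × ZMod 2) ℂ :=
  Matrix.of fun p k => vc (qm (qe k)) p

lemma s2 : ((Real.sqrt 2 : ℝ) : ℂ)⁻¹ * ((Real.sqrt 2 : ℝ) : ℂ)⁻¹ = 1 / 2 := by
  rw [← mul_inv, ← Complex.ofReal_mul, Real.mul_self_sqrt (by norm_num)]; norm_num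

/-- Unnormalised magic basis. -/
def mg : Matrix (ZMod 2 × ZMod 2) (ZMod 2 × ZMod 2) ℂ :=
  Matrix.of fun p k => qm (qe k) p.2 p.1

lemma magic_eq : magic = ((Real.sqrt 2 : ℝ) : ℂ)⁻¹ • mg := by
  ext p k; simp [magic, mg, vc]

lemma magic_star (J : Matrix (ZMod 2 × ZMod 2) (ZMod 2 × ZMod 2) ℂ) :
    magicᴴ * J * magic = (1/2 : ℂ) • (mgᴴ * J * mg) := by
  rw [magic_eq, conjTranspose_smul, Matrix.smul_mul, Matrix.smul_mul, Matrix.mul_smul, smul_smul,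
    ← s2]
  simp

lemma magic_unit : magicᴴ * magic = 1 := by
  have := magic_star 1
  rw [Matrix.mul_one, Matrix.mul_one] at this
  rw [this]
  ext ⟨p, pp⟩ ⟨q, qq⟩
  revert p pp q qq
  refine zall (zall (zall (zall ?_ ?_) (zall ?_ ?_)) (zall (zall ?_ ?_) (zall ?_ ?_)))
    (zall (zall (zall ?_ ?_) (zall ?_ ?_)) (zall (zall ?_ ?_) (zall ?_ ?_))) <;>
  · apply Complex.ext <;>
      norm_num [mg, qm, qe_re, qe_imI, qe_imJ, qe_imK, Matrix.mul_apply, Fintype.sum_prod_type, zsum]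

lemma magic_real (J : Matrix (ZMod 2 × ZMod 2) (ZMod 2 × ZMod 2) ℂ)
    (hJ : J.IsHermitian)
    (hfst : ptrFst J = (1 / 2 : ℂ) • (1 : Matrix (ZMod 2) (ZMod 2) ℂ))
    (hsnd : ptrSnd J = (1 / 2 : ℂ) • (1 : Matrix (ZMod 2) (ZMod 2) ℂ))
    (k l : ZMod 2 × ZMod 2) : ((magicᴴ * J * magic) k l).im = 0 := by
  have hr : ∀ x y, (J y x).re = (J x y).re := by
    intro x y
    have := congrArg Complex.re (hJ.apply x y)
    simpa using this
  have hi : ∀ x y, (J y x).im = -(J x y).im := by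
    intro x y
    have := congrArg Complex.im (hJ.apply x y)
    simp at this
    linarith
  have f := fun i j => congrFun (congrFun hfst i) j
  have g := fun i j => congrFun (congrFun hsnd i) j
  simp only [ptrFst, ptrSnd, zsum, Matrix.of_apply, Matrix.smul_apply, smul_eq_mul] at f g
  have fr := fun i j => congrArg Complex.re (f i j)
  have fi := fun i j => congrArg Complex.im (f i j)
  have gr := fun i j => congrArg Complex.re (g i j)
  have gi := fun i j => congrArg Complex.im (g i j)
  have fr0 := fr 0 0
  have fr1 := fr 1 1
  have fr2 := fr 0 1
  have fi2 := fi 0 1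
  have gr0 := gr 0 0
  have gr1 := gr 1 1
  have gr2 := gr 0 1
  have gi2 := gi 0 1
  have d0 := hi (0,0) (0,0)
  have d1 := hi (0,1) (0,1)
  have d2 := hi (1,0) (1,0)
  have d3 := hi (1,1) (1,1)
  have i1 := hi (0,0) (0,1)
  have i2 := hi (0,0) (1,0)
  have i3 := hi (0,0) (1,1)
  have i4 := hi (0,1) (1,0)
  have i5 := hi (0,1) (1,1)
  have i6 := hi (1,0) (1,1)
  have r1 := hr (0,0) (0,1)
  have r2 := hr (0,0) (1,0)
  have r3 := hr (0,0) (1,1)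
  have r4 := hr (0,1) (1,0)
  have r5 := hr (0,1) (1,1)
  have r6 := hr (1,0) (1,1)
  clear fr fi gr gi f g hr hi
  norm_num at fr0 fr1 fr2 fi2 gr0 gr1 gr2 gi2
  rw [magic_star]
  obtain ⟨p, pp⟩ := k
  obtain ⟨q, qq⟩ := l
  revert p pp q qq
  refine zall (zall (zall (zall ?_ ?_) (zall ?_ ?_)) (zall (zall ?_ ?_) (zall ?_ ?_)))
    (zall (zall (zall ?_ ?_) (zall ?_ ?_)) (zall (zall ?_ ?_) (zall ?_ ?_))) <;>
  · simp [mg, qm, qe_re, qe_imI, qe_imJ, qe_imK, Matrix.mul_apply, Fintype.sum_prod_type, zsum]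
    try linarith

lemma vc_proj_qe (k : ZMod 2 × ZMod 2) :
    Matrix.vecMulVec (vc (qm (qe k))) (star (vc (qm (qe k)))) = bellProj k.1 k.2 := by
  have : ∃ c : ℂ, c * star c = 1 ∧ qm (qe k) = c • Wq k.1 k.2 := by
    obtain ⟨n, m⟩ := k
    revert n m
    refine zall (zall ⟨1, ?_, ?_⟩ ⟨Complex.I, ?_, ?_⟩) (zall ⟨Complex.I, ?_, ?_⟩ ⟨-1, ?_, ?_⟩)
    all_goals first
      | (simp; done)
      | (ext r c
         revert r c
         refine zall (zall ?_ ?_) (zall ?_ ?_) <;>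
         · apply Complex.ext <;> simp [qm, qe_re, qe_imI, qe_imJ, qe_imK, Wq, ZMod.val_one, CharTwo.add_self_eq_zero])
  obtain ⟨c, hc, h⟩ := this
  rw [h]
  ext p q
  simp only [Matrix.vecMulVec_apply, vc, bellProj, bell, Matrix.of_apply, Pi.star_apply,
    Matrix.smul_apply, smul_eq_mul, star_mul, starRingEnd_apply]
  linear_combination (((Real.sqrt 2 : ℝ) : ℂ)⁻¹ * Wq k.1 k.2 p.2 p.1 *
    (star (Wq k.1 k.2 q.2 q.1) * star ((Real.sqrt 2 : ℝ) : ℂ)⁻¹)) * hc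

lemma qm_unitary (u : ℍ[ℝ]) (hu : qi u u = 1) : qm u ∈ Matrix.unitaryGroup (ZMod 2) ℂ := by
  rw [Matrix.mem_unitaryGroup_iff, Matrix.star_eq_conjTranspose, ← qm_star, ← qm_mul,
    qi_self_mul2, hu]
  simpa using qm_one

lemma qm_neg (a : ℍ[ℝ]) : qm (-a) = - qm a := by
  ext r c
  revert r c
  refine zall (zall ?_ ?_) (zall ?_ ?_) <;>
  · apply Complex.ext <;> simp [qm]

lemma vc_neg (A : Matrix (ZMod 2) (ZMod 2) ℂ) : vc (-A) = - vc A := by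
  ext p; simp [vc]

/-- quaternion of a real column -/
def qcol (O : Matrix (ZMod 2 × ZMod 2) (ZMod 2 × ZMod 2) ℝ) (k : ZMod 2 × ZMod 2) : ℍ[ℝ] :=
  ⟨O (0,0) k, O (0,1) k, O (1,1) k, O (1,0) k⟩

lemma magic_col (O : Matrix (ZMod 2 × ZMod 2) (ZMod 2 × ZMod 2) ℝ) (p k : ZMod 2 × ZMod 2) :
    (magic * O.map Complex.ofReal) p k = vc (qm (qcol O k)) p := by
  rw [magic_eq, Matrix.smul_mul, Matrix.smul_apply, vc, smul_eq_mul]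
  congr 1
  obtain ⟨r, c⟩ := p
  revert r c
  refine zall (zall ?_ ?_) (zall ?_ ?_) <;>
  · apply Complex.ext <;>
      simp [mg, qm, qe_re, qe_imI, qe_imJ, qe_imK, qcol, Matrix.mul_apply, Fintype.sum_prod_type, zsum]

lemma exists_decomp (J : Matrix (ZMod 2 × ZMod 2) (ZMod 2 × ZMod 2) ℂ)
    (hJ : J.IsHermitian)
    (hfst : ptrFst J = (1 / 2 : ℂ) • (1 : Matrix (ZMod 2) (ZMod 2) ℂ))
    (hsnd : ptrSnd J = (1 / 2 : ℂ) • (1 : Matrix (ZMod 2) (ZMod 2) ℂ)) :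
    ∃ (O : Matrix (ZMod 2 × ZMod 2) (ZMod 2 × ZMod 2) ℝ) (d : ZMod 2 × ZMod 2 → ℝ),
      Oᵀ * O = 1 ∧ (magic * O.map Complex.ofReal)ᴴ * J * (magic * O.map Complex.ofReal)
        = Matrix.diagonal (fun k => (d k : ℂ)) := by
  set S : Matrix (ZMod 2 × ZMod 2) (ZMod 2 × ZMod 2) ℝ :=
    (magicᴴ * J * magic).map Complex.re with hS
  have hSm : S.map Complex.ofReal = magicᴴ * J * magic := by
    ext k l
    apply Complex.ext
    · simp [hS]
    · rw [magic_real J hJ hfst hsnd]; simp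
  have hSh : S.IsHermitian := by
    have h := Matrix.isHermitian_conjTranspose_mul_mul magic hJ
    ext k l
    have := congrArg Complex.re (h.apply k l)
    simpa [hS] using this
  set O : Matrix (ZMod 2 × ZMod 2) (ZMod 2 × ZMod 2) ℝ := hSh.eigenvectorUnitary.1 with hO
  have hOO : Oᵀ * O = 1 := by
    have := Matrix.mem_unitaryGroup_iff'.mp hSh.eigenvectorUnitary.2
    rwa [Matrix.star_eq_conjTranspose, Matrix.conjTranspose_eq_transpose_of_trivial] at this
  have hD : Oᵀ * S * O = Matrix.diagonal hSh.eigenvalues := by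
    have := hSh.conjStarAlgAut_star_eigenvectorUnitary
    rw [Unitary.conjStarAlgAut_star_apply] at this
    exact this
  refine ⟨O, hSh.eigenvalues, hOO, ?_⟩
  have : (Oᵀ * S * O).map Complex.ofReal
      = Matrix.diagonal (fun k => (hSh.eigenvalues k : ℂ)) := by
    rw [hD]; ext k l; by_cases h : k = l <;> simp [Matrix.diagonal, h]
  rw [← this]
  have hm : ∀ A B : Matrix (ZMod 2 × ZMod 2) (ZMod 2 × ZMod 2) ℝ,
      (A * B).map Complex.ofReal = A.map Complex.ofReal * B.map Complex.ofReal :=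
    fun A B => Matrix.map_mul (f := Complex.ofRealHom)
  have hct : (O.map Complex.ofReal)ᴴ = Oᵀ.map Complex.ofReal := by
    ext k l; simp
  rw [hm, hm, hSm, conjTranspose_mul, hct]
  simp only [Matrix.mul_assoc]

/-- **Lemma 1.** The Choi state of every qubit unital channel — i.e. every 4×4
positive semidefinite matrix of trace 1 whose two partial traces are `(1/2)I₂` —
can be diagonalised in the Bell basis by local unitaries. -/
theorem bell_diagonalisation (J : Matrix (ZMod 2 × ZMod 2) (ZMod 2 × ZMod 2) ℂ)
    (hpsd : J.PosSemidef) (htr : J.trace = 1)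
    (hfst : ptrFst J = (1 / 2 : ℂ) • (1 : Matrix (ZMod 2) (ZMod 2) ℂ))
    (hsnd : ptrSnd J = (1 / 2 : ℂ) • (1 : Matrix (ZMod 2) (ZMod 2) ℂ)) :
    ∃ U ∈ Matrix.unitaryGroup (ZMod 2) ℂ, ∃ V ∈ Matrix.unitaryGroup (ZMod 2) ℂ,
      ∃ lam : ZMod 2 × ZMod 2 → ℝ, IsProbVec lam ∧
        (U ⊗ₖ V) * J * (U ⊗ₖ V)ᴴ =
          ∑ nm : ZMod 2 × ZMod 2, lam nm • bellProj nm.1 nm.2 := by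
  obtain ⟨O, d, hO, hd⟩ := exists_decomp J hpsd.1 hfst hsnd
  set N := magic * O.map Complex.ofReal with hN
  have hct : (O.map Complex.ofReal)ᴴ = Oᵀ.map Complex.ofReal := by
    ext k l; simp
  have hNN : Nᴴ * N = 1 := by
    have h1 : Oᵀ.map Complex.ofReal * O.map Complex.ofReal = 1 := by
      rw [← Matrix.map_one Complex.ofReal Complex.ofReal_zero Complex.ofReal_one, ← hO]
      exact (Matrix.map_mul (f := Complex.ofRealHom)).symm
    rw [hN, conjTranspose_mul, hct, Matrix.mul_assoc, ← Matrix.mul_assoc magicᴴ, magic_unit,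
      Matrix.one_mul, h1]
  have hNNr : N * Nᴴ = 1 := mul_eq_one_comm.mp hNN
  have hJ : J = N * Matrix.diagonal (fun k => (d k : ℂ)) * Nᴴ := by
    rw [← hd]
    calc J = (N * Nᴴ) * J * (N * Nᴴ) := by rw [hNNr, Matrix.one_mul, Matrix.mul_one]
      _ = _ := by simp only [Matrix.mul_assoc]
  have hd0 : ∀ k, 0 ≤ d k := by
    have h := hpsd.conjTranspose_mul_mul_same N
    rw [hd, Matrix.posSemidef_diagonal_iff] at h
    intro k
    exact_mod_cast h k
  have hd1 : ∑ k, d k = 1 := by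
    have h : J.trace = ∑ k, (d k : ℂ) := by
      rw [hJ, Matrix.trace_mul_comm, ← Matrix.mul_assoc, hNN, Matrix.one_mul, Matrix.trace_diagonal]
    rw [htr] at h
    exact_mod_cast h.symm
  have hsum : J = ∑ k, (d k) • Matrix.vecMulVec (vc (qm (qcol O k))) (star (vc (qm (qcol O k)))) := by
    rw [hJ]
    ext p q
    rw [Matrix.mul_apply, Matrix.sum_apply]
    refine Finset.sum_congr rfl fun k _ => ?_
    rw [Matrix.mul_diagonal, conjTranspose_apply, hN, magic_col, magic_col]
    simp [Matrix.vecMulVec_apply]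
    ring
  have hq : ∀ k l, qi (qcol O k) (qcol O l) = if k = l then 1 else 0 := by
    intro k l
    have := congrFun (congrFun hO k) l
    rw [Matrix.one_apply] at this
    rw [← this]
    simp [qi, qcol, Matrix.mul_apply, Fintype.sum_prod_type, zsum]
    ring
  obtain ⟨u, v, hu, hv, huv⟩ := exists_uv _ hq
  refine ⟨(qm u)ᵀ, ?_, qm v, qm_unitary v hv, d, ⟨hd0, hd1⟩, ?_⟩
  · have h := Matrix.mem_unitaryGroup_iff'.mp (qm_unitary u hu)
    rw [Matrix.mem_unitaryGroup_iff]
    have h2 := congrArg Matrix.transpose h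
    rw [Matrix.transpose_mul, Matrix.transpose_one] at h2
    exact h2
  · conv_lhs => rw [hsum]
    rw [Matrix.mul_sum, Matrix.sum_mul]
    refine Finset.sum_congr rfl fun k _ => ?_
    rw [Matrix.mul_smul, Matrix.smul_mul]
    congr 1
    rw [Matrix.mul_vecMulVec, Matrix.vecMulVec_mul, ← Matrix.star_mulVec, kron_vc,
      Matrix.transpose_transpose, ← qm_mul, ← qm_mul, ← vc_proj_qe]
    rcases huv k with h | h
    · rw [h]
    · rw [h, qm_neg, vc_neg, star_neg, Matrix.neg_vecMulVec, Matrix.vecMulVec_neg, neg_neg]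

end
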